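/- For the parameter θ = π/8 one has t = sin²(π/8) = (2−√2)/4 and s = sin(π/8)cos(π/8) = √2/4, and the map F = F_{π/8} satisfies F^k([E₁, P₄]) ⊆ ℬ₁ for k = 0, 1, 2 and F³([E₁, P₄]) = [E₁, P₁]; equivalently, the linear map B with matrix (1/(t−s))·[[t² − (1−s)², (1−2s)t], [(2s−1)t, (2t−1)t]] satisfies B³(P₄) = P₁ for these values of s and t. -/

import Mathlib

open Real Set Filter

noncomputable section

/-- A point in the plane. -/
abbrev Pt : Type := ℝ × ℝ

/-- The unit square `Q = [0,1] × [0,1]`. -/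
def unitSq : Set Pt := Icc (0:ℝ) 1 ×ˢ Icc (0:ℝ) 1

/-- The corners `E₁, E₂, E₃, E₄` of the unit square (cyclically indexed). -/
def Ept : Fin 4 → Pt := ![(0,0), (1,0), (1,1), (0,1)]

/-- The inner points `P₁, P₂, P₃, P₄` (cyclically indexed). -/
def Ppt (s t : ℝ) : Fin 4 → Pt := ![(s,t), (1-t,s), (1-s,1-t), (t,1-s)]

/-- The image points `P₁′, P₂′, P₃′, P₄′` (cyclically indexed). -/
def Ppt' (s t : ℝ) : Fin 4 → Pt := ![(1-s,t), (1-t,1-s), (s,1-t), (t,s)]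

/-- The triangle `𝒜ᵢ = conv {Eᵢ, Eᵢ₊₁, Pᵢ}`. -/
def Apiece (s t : ℝ) (i : Fin 4) : Set Pt :=
  convexHull ℝ {Ept i, Ept (i+1), Ppt s t i}

/-- The triangle `ℬᵢ = conv {Eᵢ, Pᵢ, Pᵢ₋₁}`. -/
def Bpiece (s t : ℝ) (i : Fin 4) : Set Pt :=
  convexHull ℝ {Ept i, Ppt s t i, Ppt s t (i-1)}

/-- The central square `𝒞 = conv {P₁, P₂, P₃, P₄}`. -/
def Cpiece (s t : ℝ) : Set Pt :=
  convexHull ℝ {Ppt s t 0, Ppt s t 1, Ppt s t 2, Ppt s t 3}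

/-- `F : Q → Q` is continuous, affine on each of the nine pieces, fixes the
corners `Eᵢ` and maps `Pᵢ` to `Pᵢ′`. -/
def IsPAMap (s t : ℝ) (F : Pt → Pt) : Prop :=
  MapsTo F unitSq unitSq ∧
  ContinuousOn F unitSq ∧
  (∀ i : Fin 4, ∃ g : Pt →ᵃ[ℝ] Pt, EqOn F g (Apiece s t i)) ∧
  (∀ i : Fin 4, ∃ g : Pt →ᵃ[ℝ] Pt, EqOn F g (Bpiece s t i)) ∧
  (∃ g : Pt →ᵃ[ℝ] Pt, EqOn F g (Cpiece s t)) ∧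
  (∀ i : Fin 4, F (Ept i) = Ept i) ∧
  (∀ i : Fin 4, F (Ppt s t i) = Ppt' s t i)

/-- The linear map `B` with matrix `(1/(t-s)) ⬝ [[t² - (1-s)², (1-2s)t], [(2s-1)t, (2t-1)t]]`. -/
def Bmap (s t : ℝ) : Pt → Pt := fun p =>
  ((1/(t-s)) * ((t^2 - (1-s)^2) * p.1 + (1-2*s)*t * p.2),
   (1/(t-s)) * ((2*s-1)*t * p.1 + (2*t-1)*t * p.2))

/-- The value `t = sin²(π/8) = (2-√2)/4`. -/
def tval : ℝ := (2 - Real.sqrt 2)/4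

/-- The value `s = sin(π/8)cos(π/8) = √2/4`. -/
def sval : ℝ := Real.sqrt 2 / 4

lemma smul_add_smul_mem_Bpiece (s t : ℝ) {a b : ℝ} (ha : 0 ≤ a) (hb : 0 ≤ b) (hab : a + b ≤ 1) :
    a • Ppt s t 0 + b • Ppt s t 3 ∈ Bpiece s t 0 := by
  have hE : Ept 0 ∈ Bpiece s t 0 := subset_convexHull ℝ _ (by simp)
  have hP : Ppt s t 0 ∈ Bpiece s t 0 := subset_convexHull ℝ _ (by simp)
  have hP' : Ppt s t 3 ∈ Bpiece s t 0 := subset_convexHull ℝ _ (by simp; right; right; rfl)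
  have h := (convex_convexHull ℝ _).sum_mem (t := Finset.univ) (w := ![1 - a - b, a, b])
    (z := ![Ept 0, Ppt s t 0, Ppt s t 3])
    (by simp [Fin.forall_fin_succ]; exact ⟨by linarith, ha, hb⟩)
    (by simp [Fin.sum_univ_succ])
    (by simp only [Finset.mem_univ, true_imp_iff, Fin.forall_fin_succ]
        exact ⟨hE, hP, hP', fun i => i.elim0⟩)
  have hE0 : Ept 0 = 0 := rfl
  simpa [Bpiece, Fin.sum_univ_succ, hE0] using h

namespace IsPAMap

variable {s t : ℝ} {F : Pt → Pt}

lemma apply_smul_add_smul (hF : IsPAMap s t F) {a b : ℝ} (ha : 0 ≤ a) (hb : 0 ≤ b)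
    (hab : a + b ≤ 1) :
    F (a • Ppt s t 0 + b • Ppt s t 3) = a • Ppt' s t 0 + b • Ppt' s t 3 := by
  obtain ⟨-, -, -, hB, -, hE, hP⟩ := hF
  obtain ⟨g, hg⟩ := hB 0
  have hg0 : g 0 = 0 := by
    rw [← hg (by simpa using smul_add_smul_mem_Bpiece s t le_rfl le_rfl (by norm_num))]
    exact hE 0
  have hlin (x : Pt) : g x = g.linear x := by
    rw [g.decomp]; simp [hg0]
  have h0 : g (Ppt s t 0) = Ppt' s t 0 := by
    rw [← hP 0, hg]
    simpa using smul_add_smul_mem_Bpiece s t zero_le_one le_rfl (by norm_num)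
  have h3 : g (Ppt s t 3) = Ppt' s t 3 := by
    rw [← hP 3, hg]
    simpa using smul_add_smul_mem_Bpiece s t le_rfl zero_le_one (by norm_num)
  rw [hg (smul_add_smul_mem_Bpiece s t ha hb hab), hlin, map_add, map_smul, map_smul,
    ← hlin, ← hlin, h0, h3]

lemma image_segment (hF : IsPAMap s t F) {v : Pt} (hv : v ∈ Bpiece s t 0) :
    F '' segment ℝ (Ept 0) v = segment ℝ (Ept 0) (F v) := by
  obtain ⟨-, -, -, hB, -, hE, -⟩ := hF
  obtain ⟨g, hg⟩ := hB 0
  have hE0 : Ept 0 ∈ Bpiece s t 0 := subset_convexHull ℝ _ (by simp)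
  rw [(hg.mono ((convex_convexHull ℝ _).segment_subset hE0 hv)).image_eq, _root_.image_segment,
    ← hg hE0, ← hg hv, hE]

end IsPAMap

lemma sin_pi_div_eight_sq : sin (π / 8) ^ 2 = tval := by
  have h := cos_sq (π / 8)
  rw [show 2 * (π / 8) = π / 4 by ring, cos_pi_div_four] at h
  rw [sin_sq, h, tval]
  ring

lemma sin_mul_cos_pi_div_eight : sin (π / 8) * cos (π / 8) = sval := by
  have h := sin_two_mul (π / 8)
  rw [show 2 * (π / 8) = π / 4 by ring, sin_pi_div_four] at h
  rw [sval]
  linarith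

lemma Bmap_iterate_Ppt :
    Bmap sval tval (Bmap sval tval (Bmap sval tval (Ppt sval tval 3))) = Ppt sval tval 0 := by
  have hr : √2 ^ 2 = 2 := sq_sqrt (by norm_num)
  have hd : 1 / (tval - sval) = -2 * (√2 + 1) := by
    have h : (tval - sval) * (-2 * (√2 + 1)) = 1 := by
      rw [tval, sval]; linear_combination hr
    exact (eq_one_div_of_mul_eq_one_right h).symm
  have h1 : Bmap sval tval (Ppt sval tval 3) = (tval, sval) := by
    simp only [Bmap, Ppt, hd, Prod.mk.injEq]
    simp [tval, sval]
    constructor <;> grind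
  have h2 : Bmap sval tval (tval, sval) = ((√2 - 1) / 2, (√2 - 1) / 2) := by
    simp only [Bmap, hd, Prod.mk.injEq]
    simp only [tval, sval]
    constructor <;> grind
  rw [h1, h2]
  simp only [Bmap, hd, Ppt]
  simp [tval, sval]
  constructor <;> grind

/-- For `θ = π/8` one has `t = (2-√2)/4` and `s = √2/4`, and
`F = F_{π/8}` satisfies `F^k([E₁,P₄]) ⊆ ℬ₁` for `k = 0,1,2` and
`F³([E₁,P₄]) = [E₁,P₁]`; equivalently, the linear map `B` satisfies `B³(P₄) = P₁`. -/
theorem special_parameter_pi_div_eight :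
    sin (π/8) ^ 2 = tval ∧
    sin (π/8) * cos (π/8) = sval ∧
    (∀ F : Pt → Pt, IsPAMap sval tval F →
      (∀ k < 3, F^[k] '' segment ℝ (Ept 0) (Ppt sval tval 3) ⊆ Bpiece sval tval 0) ∧
      F^[3] '' segment ℝ (Ept 0) (Ppt sval tval 3) = segment ℝ (Ept 0) (Ppt sval tval 0)) ∧
    Bmap sval tval (Bmap sval tval (Bmap sval tval (Ppt sval tval 3))) = Ppt sval tval 0 := by
  refine ⟨sin_pi_div_eight_sq, sin_mul_cos_pi_div_eight, fun F hF => ?_, Bmap_iterate_Ppt⟩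
  have hr : √2 ^ 2 = 2 := sq_sqrt (by norm_num)
  have hr1 : 1 ≤ √2 := one_le_sqrt.2 (by norm_num)
  have hr2 : √2 ≤ 2 := by nlinarith
  have ha : 0 ≤ (√2 - 1) / 2 := by linarith
  have hb : (0 : ℝ) ≤ 1 / 2 := by norm_num
  have hab : (√2 - 1) / 2 + 1 / 2 ≤ 1 := by linarith
  have hba : 1 / 2 + (√2 - 1) / 2 ≤ 1 := by linarith
  have hF0 : F (Ppt sval tval 3) =
      ((√2 - 1) / 2) • Ppt sval tval 0 + (1 / 2 : ℝ) • Ppt sval tval 3 := by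
    rw [hF.2.2.2.2.2.2 3]
    simp [Ppt, Ppt', sval, tval]
    constructor <;> grind
  have hF1 : F (((√2 - 1) / 2) • Ppt sval tval 0 + (1 / 2 : ℝ) • Ppt sval tval 3) =
      (1 / 2 : ℝ) • Ppt sval tval 0 + ((√2 - 1) / 2) • Ppt sval tval 3 := by
    rw [hF.apply_smul_add_smul ha hb hab]
    simp [Ppt, Ppt', sval, tval]
    constructor <;> grind
  have hF2 : F ((1 / 2 : ℝ) • Ppt sval tval 0 + ((√2 - 1) / 2) • Ppt sval tval 3) =
      Ppt sval tval 0 := by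
    rw [hF.apply_smul_add_smul hb ha hba]
    simp [Ppt, Ppt', sval, tval]
    constructor <;> grind
  have hm0 : Ppt sval tval 3 ∈ Bpiece sval tval 0 := by
    simpa using smul_add_smul_mem_Bpiece sval tval le_rfl zero_le_one (by norm_num)
  have hm1 := smul_add_smul_mem_Bpiece sval tval ha hb hab
  have hm2 := smul_add_smul_mem_Bpiece sval tval hb ha hba
  have hs1 := hF.image_segment hm0
  have hs2 := hF.image_segment hm1
  have hs3 := hF.image_segment hm2
  rw [hF0] at hs1
  rw [hF1] at hs2
  rw [hF2] at hs3
  have hsub {v : Pt} (hv : v ∈ Bpiece sval tval 0) :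
      segment ℝ (Ept 0) v ⊆ Bpiece sval tval 0 :=
    (convex_convexHull ℝ _).segment_subset (subset_convexHull ℝ _ (by simp)) hv
  constructor
  · intro k hk
    interval_cases k
    · simpa using hsub hm0
    · simpa only [Function.iterate_one, hs1] using hsub hm1
    · simpa only [Function.iterate_succ', Function.iterate_zero, Function.comp_id, image_comp,
        hs1, hs2] using hsub hm2
  · simp only [Function.iterate_succ', Function.iterate_zero, Function.comp_id, image_comp,
      hs1, hs2, hs3]
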